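/- arXiv:1709.09532 — 3 statements merged into one kernel-verified Lean document; each statement's English description precedes it below -/
import Mathlib

section
/- Let (S, 𝒜, μ) be a measure space, let 1 < p < ∞, and let X be a strictly convex real Banach space. Then the Lebesgue–Bochner space L^p(μ, X) of (equivalence classes of) strongly measurable functions f : S → X with ∫ ‖f(s)‖^p dμ(s) < ∞, normed by ‖f‖_p = (∫ ‖f(s)‖^p dμ)^{1/p}, is strictly convex. -/
open scoped ENNReal
open MeasureTheory

/-- A normed real vector space is strictly convex: for all `x`, `y` in the unit sphere
with `x ≠ y` one has `‖x + y‖ < 2`. -/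
def IsStrictlyConvex (X : Type*) [NormedAddCommGroup X] [NormedSpace ℝ X] : Prop :=
  ∀ x y : X, ‖x‖ = 1 → ‖y‖ = 1 → x ≠ y → ‖x + y‖ < 2

theorem IsStrictlyConvex.strictConvexSpace {X : Type*} [NormedAddCommGroup X] [NormedSpace ℝ X]
    (hX : IsStrictlyConvex X) : StrictConvexSpace ℝ X :=
  StrictConvexSpace.of_norm_add_ne_two fun x y hx hy hxy => (hX x y hx hy hxy).ne

/-- In a strictly convex space, `x ↦ ‖x‖ ^ r` is strictly midpoint-convex for `1 < r`. -/
theorem norm_midpoint_rpow_lt {X : Type*} [NormedAddCommGroup X] [NormedSpace ℝ X]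
    [StrictConvexSpace ℝ X] {r : ℝ} (hr : 1 < r) {u v : X} (huv : u ≠ v) :
    ‖(1 / 2 : ℝ) • (u + v)‖ ^ r < (‖u‖ ^ r + ‖v‖ ^ r) / 2 := by
  by_cases h : ‖u‖ = ‖v‖
  · have h1 := (norm_midpoint_lt_iff h).2 huv
    have h2 := Real.rpow_lt_rpow (norm_nonneg _) h1 (zero_lt_one.trans hr)
    rw [← h]
    linarith
  · have h1 : ‖(1 / 2 : ℝ) • (u + v)‖ ≤ (1 / 2 : ℝ) * ‖u‖ + (1 / 2 : ℝ) * ‖v‖ := by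
      rw [norm_smul, Real.norm_of_nonneg (by norm_num)]
      linarith [norm_add_le u v]
    have h2 := Real.rpow_le_rpow (norm_nonneg _) h1 (zero_lt_one.trans hr).le
    have h3 := (strictConvexOn_rpow hr).2 (norm_nonneg u) (norm_nonneg v) h
      (by norm_num : (0 : ℝ) < 1 / 2) (by norm_num : (0 : ℝ) < 1 / 2) (by norm_num)
    simp only [smul_eq_mul] at h3
    linarith

theorem Lp_integral_norm_rpow {S : Type*} [MeasurableSpace S] {μ : Measure S} {p : ℝ≥0∞}
    (hp : p ≠ 0) (hp' : p ≠ ⊤) {X : Type*} [NormedAddCommGroup X] (f : Lp X p μ) :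
    ∫ s, ‖f s‖ ^ p.toReal ∂μ = ‖f‖ ^ p.toReal := by
  have h0 : 0 ≤ ∫ s, ‖f s‖ ^ p.toReal ∂μ :=
    integral_nonneg fun s => Real.rpow_nonneg (norm_nonneg _) _
  rw [Lp.norm_def, (Lp.memLp f).eLpNorm_eq_integral_rpow_norm hp hp',
    ENNReal.toReal_ofReal (Real.rpow_nonneg h0 _),
    Real.rpow_inv_rpow h0 (ENNReal.toReal_pos hp hp').ne']

/-- If `1 < p < ∞` and `X` is a strictly convex real Banach space, then the
Lebesgue–Bochner space `L^p(μ, X)` is strictly convex. -/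
theorem Lp_strictlyConvex {S : Type*} [MeasurableSpace S] (μ : Measure S)
    (p : ℝ≥0∞) [Fact (1 ≤ p)] (hp : 1 < p) (hp' : p ≠ ⊤)
    (X : Type*) [NormedAddCommGroup X] [NormedSpace ℝ X] [CompleteSpace X]
    (hX : IsStrictlyConvex X) :
    IsStrictlyConvex (Lp X p μ) := by
  intro x y hx hy hxy
  have := hX.strictConvexSpace
  have hp0 : p ≠ 0 := (zero_lt_one.trans hp).ne'
  have hr : 1 < p.toReal := by
    simpa using (ENNReal.toReal_lt_toReal ENNReal.one_ne_top hp').2 hp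
  by_contra! h2
  apply hxy
  set z : Lp X p μ := (1 / 2 : ℝ) • (x + y)
  have hz : 1 ≤ ‖z‖ := by
    rw [norm_smul, Real.norm_of_nonneg (by norm_num)]
    linarith
  have hzs : ∀ᵐ s ∂μ, z s = (1 / 2 : ℝ) • (x s + y s) := by
    filter_upwards [Lp.coeFn_smul (1 / 2 : ℝ) (x + y), Lp.coeFn_add x y] with s h1 h2
    rw [h1, Pi.smul_apply, h2, Pi.add_apply]
  have hint (f : Lp X p μ) : Integrable (fun s => ‖f s‖ ^ p.toReal) μ :=
    (Lp.memLp f).integrable_norm_rpow hp0 hp'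
  let g : S → ℝ := fun s => (‖x s‖ ^ p.toReal + ‖y s‖ ^ p.toReal) / 2 - ‖z s‖ ^ p.toReal
  have hxy_int : Integrable (fun s => (‖x s‖ ^ p.toReal + ‖y s‖ ^ p.toReal) / 2) μ :=
    ((hint x).add (hint y)).div_const 2
  have hg : Integrable g μ := hxy_int.sub (hint z)
  have hg0 : 0 ≤ᵐ[μ] g := by
    filter_upwards [hzs] with s hs
    simp only [g, Pi.zero_apply, hs, sub_nonneg]
    by_cases h : x s = y s
    · simp [h, ← two_smul ℝ (y s), smul_smul]
    · exact (norm_midpoint_rpow_lt hr h).le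
  have hgi : ∫ s, g s ∂μ = 1 - ‖z‖ ^ p.toReal := by
    simp only [g]
    rw [integral_sub hxy_int (hint z), integral_div, integral_add (hint x) (hint y)]
    simp only [Lp_integral_norm_rpow hp0 hp', hx, hy, Real.one_rpow]
    norm_num
  have hgz : ∫ s, g s ∂μ = 0 :=
    le_antisymm
      (by rw [hgi]; linarith [Real.one_le_rpow hz (zero_lt_one.trans hr).le])
      (integral_nonneg_of_ae hg0)
  apply Lp.ext
  filter_upwards [hzs, (integral_eq_zero_iff_of_nonneg_ae hg0 hg).1 hgz] with s hs hgs
  by_contra h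
  have h3 := norm_midpoint_rpow_lt hr h
  simp only [g, Pi.zero_apply, hs] at hgs
  linarith
end

section
/- Let (S, 𝒜, μ) be a measure space, let 1 < p < ∞, and let X be a locally uniformly convex real Banach space. Then the Lebesgue–Bochner space L^p(μ, X) is locally uniformly convex. -/
open scoped ENNReal
open Filter MeasureTheory

/-- A Banach space is locally uniformly convex (LUC) if for every sequence `(xₙ)` in the unit
sphere and every `x` in the unit sphere with `‖xₙ + x‖ → 2` one has `‖xₙ − x‖ → 0`. -/
def LocallyUniformlyConvex (X : Type*) [NormedAddCommGroup X] [NormedSpace ℝ X] : Prop :=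
  ∀ (x : X), ‖x‖ = 1 → ∀ (xs : ℕ → X), (∀ n, ‖xs n‖ = 1) →
    Tendsto (fun n => ‖xs n + x‖) atTop (nhds 2) →
    Tendsto (fun n => ‖xs n - x‖) atTop (nhds 0)

/-- The defect of `x, y` in the midpoint convexity inequality for `‖·‖ ^ r`. -/
noncomputable def rpowDefect {X : Type*} [NormedAddCommGroup X] (r : ℝ) (x y : X) : ℝ :=
  (‖x‖ ^ r + ‖y‖ ^ r) / 2 - (‖x + y‖ / 2) ^ r

theorem hasDerivAt_midpoint_rpow_defect {r : ℝ} (hr : 1 < r) (a b : ℝ) :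
    HasDerivAt (fun t : ℝ => (a ^ r + t ^ r) / 2 - ((a + t) / 2) ^ r)
      (r / 2 * (b ^ (r - 1) - ((a + b) / 2) ^ (r - 1))) b := by
  have h₁ := Real.hasDerivAt_rpow_const (x := b) (p := r) (Or.inr hr.le)
  have h₂ := (((hasDerivAt_id b).const_add a).div_const 2).rpow_const (p := r) (Or.inr hr.le)
  refine (((h₁.const_add (a ^ r)).div_const 2).sub h₂).congr_deriv ?_
  simp only [id]
  ring

theorem continuous_midpoint_rpow_defect {r : ℝ} (hr : 1 < r) (a : ℝ) :
    Continuous (fun t : ℝ => (a ^ r + t ^ r) / 2 - ((a + t) / 2) ^ r) :=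
  continuous_iff_continuousAt.2 fun b => (hasDerivAt_midpoint_rpow_defect hr a b).continuousAt

theorem strictMonoOn_midpoint_rpow_defect {r : ℝ} (hr : 1 < r) {a : ℝ} (ha : 0 ≤ a) :
    StrictMonoOn (fun t : ℝ => (a ^ r + t ^ r) / 2 - ((a + t) / 2) ^ r) (Set.Ici a) := by
  refine strictMonoOn_of_deriv_pos (convex_Ici a)
    (continuous_midpoint_rpow_defect hr a).continuousOn fun t ht => ?_
  rw [interior_Ici, Set.mem_Ioi] at ht
  rw [(hasDerivAt_midpoint_rpow_defect hr a t).deriv]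
  have : ((a + t) / 2) ^ (r - 1) < t ^ (r - 1) :=
    Real.rpow_lt_rpow (by linarith) (by linarith) (by linarith)
  exact mul_pos (by linarith) (by linarith)

theorem strictAntiOn_midpoint_rpow_defect {r : ℝ} (hr : 1 < r) {a : ℝ} :
    StrictAntiOn (fun t : ℝ => (a ^ r + t ^ r) / 2 - ((a + t) / 2) ^ r) (Set.Icc 0 a) := by
  refine strictAntiOn_of_deriv_neg (convex_Icc 0 a)
    (continuous_midpoint_rpow_defect hr a).continuousOn fun t ht => ?_
  rw [interior_Icc, Set.mem_Ioo] at ht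
  rw [(hasDerivAt_midpoint_rpow_defect hr a t).deriv]
  have : t ^ (r - 1) < ((a + t) / 2) ^ (r - 1) :=
    Real.rpow_lt_rpow (by linarith) (by linarith) (by linarith)
  exact mul_neg_of_pos_of_neg (by linarith) (by linarith)

theorem midpoint_rpow_defect_self (r a : ℝ) : (a ^ r + a ^ r) / 2 - ((a + a) / 2) ^ r = 0 := by
  rw [add_self_div_two, add_self_div_two, sub_self]

theorem midpoint_rpow_defect_nonneg {r : ℝ} (hr : 1 < r) {a b : ℝ} (ha : 0 ≤ a) (hb : 0 ≤ b) :
    0 ≤ (a ^ r + b ^ r) / 2 - ((a + b) / 2) ^ r := by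
  rw [← midpoint_rpow_defect_self r a]
  rcases le_total a b with h | h
  · exact (strictMonoOn_midpoint_rpow_defect hr ha).monotoneOn Set.self_mem_Ici h h
  · exact (strictAntiOn_midpoint_rpow_defect hr).antitoneOn ⟨hb, h⟩ ⟨ha, le_rfl⟩ h

theorem tendsto_of_midpoint_rpow_defect {ι : Type*} {l : Filter ι} {r : ℝ} (hr : 1 < r) {a : ℝ}
    (ha : 0 ≤ a) {b : ι → ℝ} (hb : ∀ i, 0 ≤ b i)
    (h : Tendsto (fun i => (a ^ r + b i ^ r) / 2 - ((a + b i) / 2) ^ r) l (nhds 0)) :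
    Tendsto b l (nhds a) := by
  have h0 := midpoint_rpow_defect_self r a
  refine tendsto_order.2 ⟨fun c hc => ?_, fun c hc => ?_⟩
  · rcases lt_or_ge c 0 with hc0 | hc0
    · exact .of_forall fun i => hc0.trans_le (hb i)
    have hpos := strictAntiOn_midpoint_rpow_defect hr ⟨hc0, hc.le⟩ ⟨ha, le_rfl⟩ hc
    simp only [h0] at hpos
    filter_upwards [h.eventually_lt_const hpos] with i hi
    by_contra! hle
    exact hi.not_ge ((strictAntiOn_midpoint_rpow_defect hr).antitoneOn ⟨hb i, hle.trans hc.le⟩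
      ⟨hc0, hc.le⟩ hle)
  · have hpos := strictMonoOn_midpoint_rpow_defect hr ha Set.self_mem_Ici hc.le hc
    simp only [h0] at hpos
    filter_upwards [h.eventually_lt_const hpos] with i hi
    by_contra! hle
    exact hi.not_ge ((strictMonoOn_midpoint_rpow_defect hr ha).monotoneOn hc.le
      (hc.le.trans hle) hle)

section rpowDefect

variable {X : Type*} [NormedAddCommGroup X] {r : ℝ}

theorem midpoint_norm_rpow_defect_le_rpowDefect (hr : 1 < r) (x y : X) :
    (‖x‖ ^ r + ‖y‖ ^ r) / 2 - ((‖x‖ + ‖y‖) / 2) ^ r ≤ rpowDefect r x y := by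
  have := norm_add_le x y
  unfold rpowDefect
  gcongr

theorem rpowDefect_nonneg (hr : 1 < r) (x y : X) : 0 ≤ rpowDefect r x y :=
  (midpoint_rpow_defect_nonneg hr (norm_nonneg x) (norm_nonneg y)).trans
    (midpoint_norm_rpow_defect_le_rpowDefect hr x y)

theorem tendsto_norm_of_rpowDefect {ι : Type*} {l : Filter ι} (hr : 1 < r) {x : X} {y : ι → X}
    (h : Tendsto (fun i => rpowDefect r x (y i)) l (nhds 0)) :
    Tendsto (fun i => ‖y i‖) l (nhds ‖x‖) :=
  tendsto_of_midpoint_rpow_defect hr (norm_nonneg x) (fun i => norm_nonneg (y i)) <|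
    squeeze_zero (fun i => midpoint_rpow_defect_nonneg hr (norm_nonneg x) (norm_nonneg (y i)))
      (fun i => midpoint_norm_rpow_defect_le_rpowDefect hr x (y i)) h

theorem tendsto_norm_add_of_rpowDefect {ι : Type*} {l : Filter ι} (hr : 1 < r) {x : X}
    {y : ι → X} (h : Tendsto (fun i => rpowDefect r x (y i)) l (nhds 0)) :
    Tendsto (fun i => ‖y i + x‖) l (nhds (2 * ‖x‖)) := by
  have hr0 : 0 < r := by linarith
  have hpow := (((tendsto_norm_of_rpowDefect hr h).rpow_const (p := r)
    (Or.inr hr0.le)).const_add (‖x‖ ^ r)).div_const 2 |>.sub h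
  rw [add_self_div_two, sub_zero] at hpow
  have hroot := (hpow.rpow_const (p := r⁻¹) (Or.inr (by positivity))).const_mul 2
  rw [Real.rpow_rpow_inv (norm_nonneg x) hr0.ne'] at hroot
  refine hroot.congr fun i => ?_
  rw [rpowDefect, sub_sub_cancel, Real.rpow_rpow_inv (by positivity) hr0.ne', add_comm x]
  ring

end rpowDefect

theorem LocallyUniformlyConvex.tendsto_of_tendsto_norm {X : Type*} [NormedAddCommGroup X]
    [NormedSpace ℝ X] (hX : LocallyUniformlyConvex X) {x : X} {y : ℕ → X}
    (hy : Tendsto (fun n => ‖y n‖) atTop (nhds ‖x‖))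
    (hadd : Tendsto (fun n => ‖y n + x‖) atTop (nhds (2 * ‖x‖))) :
    Tendsto y atTop (nhds x) := by
  rcases eq_or_ne x 0 with rfl | hx
  · rw [norm_zero] at hy
    exact tendsto_zero_iff_norm_tendsto_zero.2 hy
  have hx0 : 0 < ‖x‖ := norm_pos_iff.2 hx
  have hunit : ∀ {v : X}, v ≠ 0 → ‖‖v‖⁻¹ • v‖ = 1 := fun hv => by
    rw [norm_smul, norm_inv, norm_norm, inv_mul_cancel₀ (norm_ne_zero_iff.2 hv)]
  classical
  set z : ℕ → X := fun n => if y n = 0 then ‖x‖⁻¹ • x else ‖y n‖⁻¹ • y n with hz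
  have hz_unit : ∀ n, ‖z n‖ = 1 := fun n => by
    by_cases h : y n = 0
    · simp only [hz, if_pos h, hunit hx]
    · simp only [hz, if_neg h, hunit h]
  have hz_eq : ∀ᶠ n in atTop, y n = ‖y n‖ • z n := by
    filter_upwards [hy.eventually_const_lt hx0] with n hn
    have h : y n ≠ 0 := norm_pos_iff.1 hn
    simp only [hz, if_neg h, smul_inv_smul₀ hn.ne']
  have hdiff : Tendsto (fun n => z n - ‖x‖⁻¹ • y n) atTop (nhds 0) := by
    rw [tendsto_zero_iff_norm_tendsto_zero]
    have h := ((hy.const_mul ‖x‖⁻¹).const_sub 1).norm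
    rw [inv_mul_cancel₀ hx0.ne', sub_self, norm_zero] at h
    refine h.congr' ?_
    filter_upwards [hz_eq] with n hn
    conv_rhs => rw [hn]
    have hsub : z n - (‖x‖⁻¹ * ‖y n‖) • z n = (1 - ‖x‖⁻¹ * ‖y n‖) • z n := by
      rw [sub_smul, one_smul]
    rw [smul_smul, hsub, norm_smul, hz_unit, mul_one]
  have hz_add : Tendsto (fun n => ‖z n + ‖x‖⁻¹ • x‖) atTop (nhds 2) := by
    have h := hadd.const_mul ‖x‖⁻¹
    rw [mul_left_comm, inv_mul_cancel₀ hx0.ne', mul_one] at h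
    refine tendsto_of_tendsto_of_dist h (squeeze_zero (fun _ => dist_nonneg) (fun n => ?_)
      (tendsto_zero_iff_norm_tendsto_zero.1 hdiff))
    have h' : ‖x‖⁻¹ * ‖y n + x‖ = ‖‖x‖⁻¹ • y n + ‖x‖⁻¹ • x‖ := by
      rw [← smul_add, norm_smul, norm_inv, norm_norm]
    rw [h', dist_comm]
    refine (dist_norm_norm_le _ _).trans_eq ?_
    rw [add_sub_add_right_eq_sub]
  have hz_lim := tendsto_iff_norm_sub_tendsto_zero.2 (hX _ (hunit hx) z hz_unit hz_add)
  have h := hy.smul hz_lim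
  rw [smul_inv_smul₀ hx0.ne'] at h
  exact h.congr' (hz_eq.mono fun n hn => hn.symm)

theorem LocallyUniformlyConvex.tendsto_of_rpowDefect {X : Type*} [NormedAddCommGroup X]
    [NormedSpace ℝ X] (hX : LocallyUniformlyConvex X) {r : ℝ} (hr : 1 < r) {x : X} {y : ℕ → X}
    (h : Tendsto (fun n => rpowDefect r x (y n)) atTop (nhds 0)) : Tendsto y atTop (nhds x) :=
  hX.tendsto_of_tendsto_norm (tendsto_norm_of_rpowDefect hr h) (tendsto_norm_add_of_rpowDefect hr h)

section Lp

variable {S : Type*} [MeasurableSpace S] {μ : Measure S} {p : ℝ≥0∞} {X : Type*}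
  [NormedAddCommGroup X]

theorem integrable_norm_rpow_Lp (hp : p ≠ 0) (hp' : p ≠ ⊤) (f : Lp X p μ) :
    Integrable (fun s => ‖f s‖ ^ p.toReal) μ :=
  (Lp.memLp f).integrable_norm_rpow hp hp'

theorem integral_norm_rpow_Lp (hp : p ≠ 0) (hp' : p ≠ ⊤) (f : Lp X p μ) :
    ∫ s, ‖f s‖ ^ p.toReal ∂μ = ‖f‖ ^ p.toReal := by
  have h : 0 ≤ ∫ s, ‖f s‖ ^ p.toReal ∂μ := integral_nonneg fun s => by positivity
  rw [Lp.norm_def, (Lp.memLp f).eLpNorm_eq_integral_rpow_norm hp hp',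
    ENNReal.toReal_ofReal (by positivity),
    Real.rpow_inv_rpow h (ENNReal.toReal_pos hp hp').ne']

theorem norm_add_Lp_rpow_ae_eq (f g : Lp X p μ) :
    (fun s => (‖f s + g s‖ / 2) ^ p.toReal) =ᵐ[μ]
      fun s => (1 / 2) ^ p.toReal * ‖(f + g) s‖ ^ p.toReal := by
  filter_upwards [Lp.coeFn_add f g] with s hs
  rw [hs, Pi.add_apply, ← Real.mul_rpow (by norm_num) (norm_nonneg _), one_div_mul_eq_div]

theorem integrable_norm_add_Lp_rpow (hp : p ≠ 0) (hp' : p ≠ ⊤) (f g : Lp X p μ) :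
    Integrable (fun s => (‖f s + g s‖ / 2) ^ p.toReal) μ :=
  ((integrable_norm_rpow_Lp hp hp' (f + g)).const_mul _).congr (norm_add_Lp_rpow_ae_eq f g).symm

theorem integrable_rpowDefect_Lp (hp : p ≠ 0) (hp' : p ≠ ⊤) (f g : Lp X p μ) :
    Integrable (fun s => rpowDefect p.toReal (f s) (g s)) μ :=
  (((integrable_norm_rpow_Lp hp hp' f).add (integrable_norm_rpow_Lp hp hp' g)).div_const 2).sub
    (integrable_norm_add_Lp_rpow hp hp' f g)

theorem integral_rpowDefect_Lp [Fact (1 ≤ p)] (hp : p ≠ 0) (hp' : p ≠ ⊤) (f g : Lp X p μ) :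
    ∫ s, rpowDefect p.toReal (f s) (g s) ∂μ = rpowDefect p.toReal f g := by
  have hf := integrable_norm_rpow_Lp hp hp' f
  have hg := integrable_norm_rpow_Lp hp hp' g
  have hfg : Integrable (fun s => (‖f s‖ ^ p.toReal + ‖g s‖ ^ p.toReal) / 2) μ :=
    (hf.add hg).div_const 2
  simp only [rpowDefect]
  rw [integral_sub hfg (integrable_norm_add_Lp_rpow hp hp' f g),
    integral_div, integral_add hf hg, integral_congr_ae (norm_add_Lp_rpow_ae_eq f g),
    integral_const_mul, integral_norm_rpow_Lp hp hp', integral_norm_rpow_Lp hp hp',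
    integral_norm_rpow_Lp hp hp', ← Real.mul_rpow (by norm_num) (norm_nonneg _),
    one_div_mul_eq_div]

/-- Along a subsequence, convergence of the `L^p` defects to `0` passes to the pointwise defects. -/
theorem exists_seq_tendsto_ae_rpowDefect [Fact (1 ≤ p)] (hp : 1 < p) (hp' : p ≠ ⊤) {f : Lp X p μ}
    {fs : ℕ → Lp X p μ} (h : Tendsto (fun n => rpowDefect p.toReal f (fs n)) atTop (nhds 0)) :
    ∃ ns : ℕ → ℕ, StrictMono ns ∧ ∀ᵐ s ∂μ,
      Tendsto (fun n => rpowDefect p.toReal (f s) (fs (ns n) s)) atTop (nhds 0) := by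
  have hp0 : p ≠ 0 := (zero_lt_one.trans hp).ne'
  have hr : 1 < p.toReal := by simpa using ENNReal.toReal_strict_mono hp' hp
  have hint := fun n => integrable_rpowDefect_Lp hp0 hp' f (fs n)
  refine (tendstoInMeasure_of_tendsto_eLpNorm (p := 1) (g := fun _ => (0 : ℝ)) one_ne_zero
    (fun n => (hint n).aestronglyMeasurable) aestronglyMeasurable_const ?_).exists_seq_tendsto_ae
  rw [← ENNReal.ofReal_zero]
  refine (ENNReal.tendsto_ofReal h).congr fun n => ?_
  rw [eLpNorm_one_eq_lintegral_enorm, ← integral_rpowDefect_Lp hp0 hp',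
    ofReal_integral_eq_lintegral_ofReal (hint n) (.of_forall fun s => rpowDefect_nonneg hr _ _)]
  refine lintegral_congr fun s => ?_
  rw [Pi.sub_apply, sub_zero, Real.enorm_of_nonneg (rpowDefect_nonneg hr _ _)]

/-- Almost everywhere convergence together with convergence of the norms implies convergence
in `L^p`. -/
theorem tendsto_Lp_of_ae_tendsto_of_tendsto_norm [Fact (1 ≤ p)] (hp : 1 < p) (hp' : p ≠ ⊤)
    {f : Lp X p μ} {fs : ℕ → Lp X p μ}
    (hae : ∀ᵐ s ∂μ, Tendsto (fun n => fs n s) atTop (nhds (f s)))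
    (hnorm : Tendsto (fun n => ‖fs n‖) atTop (nhds ‖f‖)) : Tendsto fs atTop (nhds f) := by
  have hp0 : p ≠ 0 := (zero_lt_one.trans hp).ne'
  have hr : 1 < p.toReal := by simpa using ENNReal.toReal_strict_mono hp' hp
  have hr0 : 0 < p.toReal := by linarith
  set r := p.toReal with hr_def
  have hf := integrable_norm_rpow_Lp hp0 hp' f
  have hw := fun n => integrable_rpowDefect_Lp hp0 hp' f (-fs n)
  simp only [← hr_def] at hf hw
  have hpos : Tendsto (fun n => ∫ s, max (‖f s‖ ^ r - rpowDefect r (f s) ((-fs n) s)) 0 ∂μ) atTop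
      (nhds 0) := by
    have hlim : ∀ᵐ s ∂μ, Tendsto (fun n => max (‖f s‖ ^ r - rpowDefect r (f s) ((-fs n) s)) 0)
        atTop (nhds 0) := by
      filter_upwards [hae, ae_all_iff.2 fun n => Lp.coeFn_neg (fs n)] with s hs hneg
      have h₁ := ((hs.norm.rpow_const (p := r) (Or.inr hr0.le)).const_add (‖f s‖ ^ r)).div_const 2
      have h₂ := ((hs.const_sub (f s)).norm.div_const 2).rpow_const (p := r) (Or.inr hr0.le)
      have h₃ := ((h₁.sub h₂).const_sub (‖f s‖ ^ r)).max (tendsto_const_nhds (x := (0 : ℝ)))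
      rw [add_self_div_two, sub_self (f s), norm_zero, zero_div, Real.zero_rpow hr0.ne', sub_zero,
        sub_self, max_self] at h₃
      simpa only [rpowDefect, hneg, Pi.neg_apply, norm_neg, ← sub_eq_add_neg] using h₃
    have := tendsto_integral_of_dominated_convergence (fun s => ‖f s‖ ^ r)
      (fun n => ((hf.sub (hw n)).pos_part).aestronglyMeasurable) hf
      (fun n => .of_forall fun s => ?_) hlim
    · simpa using this
    · rw [Real.norm_of_nonneg (le_max_right _ _)]
      have := rpowDefect_nonneg hr (f s) ((-fs n) s)
      exact max_le (by simpa using this) (by positivity)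
  have hle : ∀ n, ‖f‖ ^ r - rpowDefect r f (-fs n) ≤
      ∫ s, max (‖f s‖ ^ r - rpowDefect r (f s) ((-fs n) s)) 0 ∂μ := fun n => by
    rw [← integral_norm_rpow_Lp hp0 hp', ← integral_rpowDefect_Lp hp0 hp', ← integral_sub hf (hw n)]
    exact integral_mono (hf.sub (hw n)) (hf.sub (hw n)).pos_part fun s => le_max_left _ _
  have hsub : Tendsto (fun n => (‖f - fs n‖ / 2) ^ r) atTop (nhds 0) := by
    have h := ((hnorm.rpow_const (p := r) (Or.inr hr0.le)).sub_const (‖f‖ ^ r)).div_const 2 |>.add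
      hpos
    rw [sub_self, zero_div, add_zero] at h
    refine squeeze_zero (fun n => by positivity) (fun n => ?_) h
    have := hle n
    rw [rpowDefect, norm_neg, ← sub_eq_add_neg] at this
    linarith
  have hroot := (hsub.rpow_const (p := r⁻¹) (Or.inr (by positivity))).const_mul 2
  rw [Real.zero_rpow (inv_ne_zero hr0.ne'), mul_zero] at hroot
  refine tendsto_iff_norm_sub_tendsto_zero.2 (hroot.congr fun n => ?_)
  rw [Real.rpow_rpow_inv (by positivity) hr0.ne', norm_sub_rev]
  ring

end Lp

/-- If `1 < p < ∞` and `X` is a locally uniformly convex real Banach space, then the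
Lebesgue–Bochner space `L^p(μ, X)` is locally uniformly convex. -/
theorem Lp_locallyUniformlyConvex {S : Type*} [MeasurableSpace S] (μ : Measure S)
    (p : ℝ≥0∞) [Fact (1 ≤ p)] (hp : 1 < p) (hp' : p ≠ ⊤)
    (X : Type*) [NormedAddCommGroup X] [NormedSpace ℝ X] [CompleteSpace X]
    (hX : LocallyUniformlyConvex X) :
    LocallyUniformlyConvex (Lp X p μ) := by
  intro f hf fs hfs hadd
  have hp0 : p ≠ 0 := (zero_lt_one.trans hp).ne'
  have hr : 1 < p.toReal := by simpa using ENNReal.toReal_strict_mono hp' hp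
  have hdefect : Tendsto (fun n => rpowDefect p.toReal f (fs n)) atTop (nhds 0) := by
    have h := ((hadd.div_const 2).rpow_const (p := p.toReal) (Or.inr (by linarith))).const_sub 1
    rw [div_self two_ne_zero, Real.one_rpow, sub_self] at h
    refine h.congr fun n => ?_
    rw [rpowDefect, hf, hfs, Real.one_rpow, add_self_div_two, add_comm f]
  suffices Tendsto fs atTop (nhds f) from tendsto_iff_norm_sub_tendsto_zero.1 this
  refine tendsto_of_subseq_tendsto fun ns hns => ?_
  obtain ⟨ms, -, hms⟩ := exists_seq_tendsto_ae_rpowDefect hp hp' (hdefect.comp hns)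
  refine ⟨ms, tendsto_Lp_of_ae_tendsto_of_tendsto_norm hp hp' ?_ ?_⟩
  · filter_upwards [hms] with s hs using hX.tendsto_of_rpowDefect hr hs
  · simp only [hfs, hf, tendsto_const_nhds]
end

section
/- Let (S, 𝒜, μ) be a measure space, let 1 < p < ∞, and let X be a uniformly convex real Banach space. Then the Lebesgue–Bochner space L^p(μ, X) is uniformly convex. -/
open scoped ENNReal
open MeasureTheory

/-- A quantitative form of the strict convexity of `t ↦ t ^ q`, allowing `t = 1` once the
midpoint is truncated below `1`. -/
lemma exists_min_midpoint_rpow_add_le {q : ℝ} (hq : 1 < q) {η : ℝ} (hη : 0 < η) (hη1 : η ≤ 1) :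
    ∃ m, 0 < m ∧ ∀ t ∈ Set.Icc (0 : ℝ) 1,
      (min (1 - η) ((1 + t) / 2)) ^ q + m ≤ (1 + t ^ q) / 2 := by
  have hq0 : 0 < q := by linarith
  have hcont : ContinuousOn
      (fun t : ℝ => (1 + t ^ q) / 2 - (min (1 - η) ((1 + t) / 2)) ^ q) (Set.Icc 0 1) := by
    have h1 : Continuous fun t : ℝ => t ^ q := Real.continuous_rpow_const hq0.le
    have h2 : Continuous fun t : ℝ => min (1 - η) ((1 + t) / 2) := by fun_prop
    have h3 := h1.comp h2
    exact (((continuous_const.add h1).div_const 2).sub h3).continuousOn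
  obtain ⟨t₀, ht₀, hmin⟩ := isCompact_Icc.exists_isMinOn
    (Set.nonempty_Icc.2 zero_le_one) hcont
  refine ⟨(1 + t₀ ^ q) / 2 - (min (1 - η) ((1 + t₀) / 2)) ^ q, ?_, fun t ht => ?_⟩
  · have hmin0 : 0 ≤ min (1 - η) ((1 + t₀) / 2) :=
      le_min (by linarith) (by linarith [ht₀.1])
    rcases ht₀.2.eq_or_lt with h | h
    · have h1 : (min (1 - η) ((1 + t₀) / 2)) ^ q < 1 :=
        Real.rpow_lt_one hmin0 ((min_le_left _ _).trans_lt (by linarith)) hq0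
      have h2 : t₀ ^ q = 1 := by rw [h, Real.one_rpow]
      linarith
    · have h1 : (min (1 - η) ((1 + t₀) / 2)) ^ q ≤ ((1 + t₀) / 2) ^ q :=
        Real.rpow_le_rpow hmin0 (min_le_right _ _) hq0.le
      have h2 := (strictConvexOn_rpow hq).2 (Set.mem_Ici.2 zero_le_one)
        (Set.mem_Ici.2 ht₀.1) h.ne' (show (0 : ℝ) < 1 / 2 by norm_num)
        (show (0 : ℝ) < 1 / 2 by norm_num) (by norm_num)
      simp only [smul_eq_mul, Real.one_rpow] at h2
      rw [show 1 / 2 * 1 + 1 / 2 * t₀ = (1 + t₀) / 2 by ring] at h2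
      linarith
  · have := isMinOn_iff.1 hmin t ht
    linarith

section Pointwise

variable {X : Type*} [NormedAddCommGroup X]

lemma norm_add_div_two_rpow_le {q : ℝ} (hq : 1 ≤ q) (x y : X) :
    (‖x + y‖ / 2) ^ q ≤ (‖x‖ ^ q + ‖y‖ ^ q) / 2 := by
  have h1 : (‖x + y‖ / 2) ^ q ≤ ((‖x‖ + ‖y‖) / 2) ^ q :=
    Real.rpow_le_rpow (by positivity) (by linarith [norm_add_le x y]) (by linarith)
  have h2 := (convexOn_rpow hq).2 (Set.mem_Ici.2 (norm_nonneg x))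
    (Set.mem_Ici.2 (norm_nonneg y)) (show (0 : ℝ) ≤ 1 / 2 by norm_num)
    (show (0 : ℝ) ≤ 1 / 2 by norm_num) (by norm_num)
  simp only [smul_eq_mul] at h2
  rw [show 1 / 2 * ‖x‖ + 1 / 2 * ‖y‖ = (‖x‖ + ‖y‖) / 2 by ring] at h2
  linarith

variable (X) [NormedSpace ℝ X] [UniformConvexSpace X]

lemma exists_norm_rpow_uniform_convex_of_norm_eq_one {q : ℝ} (hq : 1 < q) {η : ℝ} (hη : 0 < η) :
    ∃ c, 0 < c ∧ ∀ x y : X, ‖x‖ = 1 → ‖y‖ ≤ 1 →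
      (‖x + y‖ / 2) ^ q + c * ‖x - y‖ ^ q ≤ (1 / 2 + c * η) * (‖x‖ ^ q + ‖y‖ ^ q) := by
  have hq0 : 0 < q := by linarith
  obtain ⟨δ, hδ, hX⟩ := exists_forall_closed_ball_dist_add_le_two_sub X
    (Real.rpow_pos_of_pos hη q⁻¹)
  obtain ⟨m, hm, h⟩ := exists_min_midpoint_rpow_add_le hq
    (η := min (δ / 2) 1) (lt_min (by linarith) one_pos) (min_le_right _ _)
  have h2q : (0 : ℝ) < 2 ^ q := by positivity
  refine ⟨m / 2 ^ q, by positivity, fun x y hx hy => ?_⟩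
  have hc : 0 < m / 2 ^ q := by positivity
  have hyq : 0 ≤ ‖y‖ ^ q := by positivity
  rcases le_total (‖x - y‖ ^ q) (η * (‖x‖ ^ q + ‖y‖ ^ q)) with hxy | hxy
  · have h1 := norm_add_div_two_rpow_le hq.le x y
    have h2 := mul_le_mul_of_nonneg_left hxy hc.le
    linarith
  · rw [hx, Real.one_rpow] at hxy ⊢
    have hε : η ^ q⁻¹ ≤ ‖x - y‖ := by
      rw [Real.rpow_inv_le_iff_of_pos hη.le (norm_nonneg _) hq0]
      nlinarith
    have hsum := hX hx.le hy hε
    have htri := norm_add_le x y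
    have hle : ‖x + y‖ / 2 ≤ min (1 - min (δ / 2) 1) ((1 + ‖y‖) / 2) := by
      refine le_min ?_ (by linarith)
      rcases le_total (δ / 2) 1 with hδ1 | hδ1
      · rw [min_eq_left hδ1]; linarith
      · rw [min_eq_right hδ1]; linarith
    have h1 := Real.rpow_le_rpow (by positivity) hle hq0.le
    have h2 := h ‖y‖ ⟨norm_nonneg _, hy⟩
    have h3 : ‖x - y‖ ^ q ≤ 2 ^ q :=
      Real.rpow_le_rpow (norm_nonneg _) (by linarith [norm_sub_le x y]) hq0.le
    have h4 : m / 2 ^ q * ‖x - y‖ ^ q ≤ m :=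
      (mul_le_mul_of_nonneg_left h3 hc.le).trans_eq (div_mul_cancel₀ _ h2q.ne')
    have h5 : 0 ≤ m / 2 ^ q * η * (1 + ‖y‖ ^ q) := by positivity
    linarith

/-- In a uniformly convex space, the `q`-th power of the norm is uniformly convex, up to an
error that is small compared with the modulus. -/
lemma exists_norm_rpow_uniform_convex {q : ℝ} (hq : 1 < q) {η : ℝ} (hη : 0 < η) :
    ∃ c, 0 < c ∧ ∀ x y : X,
      (‖x + y‖ / 2) ^ q + c * ‖x - y‖ ^ q ≤ (1 / 2 + c * η) * (‖x‖ ^ q + ‖y‖ ^ q) := by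
  obtain ⟨c, hc, h⟩ := exists_norm_rpow_uniform_convex_of_norm_eq_one X hq hη
  refine ⟨c, hc, fun x y => ?_⟩
  wlog hyx : ‖y‖ ≤ ‖x‖ generalizing x y
  · have := this y x (le_of_not_ge hyx)
    rwa [add_comm y x, norm_sub_rev, add_comm (‖y‖ ^ q)] at this
  rcases (norm_nonneg x).eq_or_lt with hx | hx
  · have hx0 : x = 0 := norm_eq_zero.1 hx.symm
    have hy0 : y = 0 := norm_le_zero_iff.1 (hyx.trans hx.symm.le)
    have hq0 : q ≠ 0 := by linarith
    simp [hx0, hy0, Real.zero_rpow hq0]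
  · set r := ‖x‖ with hr
    have hscale : ∀ z : X, ‖z‖ = r * ‖r⁻¹ • z‖ := fun z => by
      rw [norm_smul, Real.norm_of_nonneg (by positivity), mul_inv_cancel_left₀ hx.ne']
    have h1 : ‖r⁻¹ • x‖ = 1 := by
      rw [norm_smul, Real.norm_of_nonneg (by positivity), inv_mul_cancel₀ hx.ne']
    have h2 : ‖r⁻¹ • y‖ ≤ 1 := by
      rw [norm_smul, Real.norm_of_nonneg (by positivity)]
      exact (inv_mul_le_one₀ hx).2 hyx
    have h3 := mul_le_mul_of_nonneg_left (h _ _ h1 h2) (Real.rpow_nonneg hx.le q)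
    rw [← smul_add, ← smul_sub, h1] at h3
    rw [hscale (x + y), hscale (x - y), hscale y, mul_div_assoc,
      Real.mul_rpow hx.le (by positivity), Real.mul_rpow hx.le (by positivity),
      Real.mul_rpow hx.le (by positivity)]
    rw [Real.one_rpow] at h3
    linarith

end Pointwise

lemma MeasureTheory.Lp.norm_rpow_eq_integral {S X : Type*} [MeasurableSpace S] {μ : Measure S}
    [NormedAddCommGroup X] {p : ℝ≥0∞} (hp : p ≠ 0) (hp' : p ≠ ⊤) (f : Lp X p μ) :
    ‖f‖ ^ p.toReal = ∫ a, ‖f a‖ ^ p.toReal ∂μ := by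
  have h0 : p.toReal ≠ 0 := (ENNReal.toReal_pos hp hp').ne'
  have hI : 0 ≤ ∫ a, ‖f a‖ ^ p.toReal ∂μ := integral_nonneg fun a => by positivity
  rw [Lp.norm_def, (Lp.memLp f).eLpNorm_eq_integral_rpow_norm hp hp',
    ENNReal.toReal_ofReal (by positivity), Real.rpow_inv_rpow hI h0]

/-- If `1 < p < ∞` and `X` is a uniformly convex real Banach space, then the
Lebesgue–Bochner space `L^p(μ, X)` is uniformly convex. -/
theorem Lp_uniformConvex {S : Type*} [MeasurableSpace S] (μ : Measure S)
    (p : ℝ≥0∞) [Fact (1 ≤ p)] (hp : 1 < p) (hp' : p ≠ ⊤)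
    (X : Type*) [NormedAddCommGroup X] [NormedSpace ℝ X] [CompleteSpace X]
    [UniformConvexSpace X] :
    UniformConvexSpace (Lp X p μ) := by
  have hp0 : p ≠ 0 := (zero_lt_one.trans hp).ne'
  have hq : 1 < p.toReal := by
    simpa using (ENNReal.toReal_lt_toReal ENNReal.one_ne_top hp').2 hp
  have hq0 : 0 < p.toReal := by linarith
  refine ⟨fun ε hε => ?_⟩
  have hεq : 0 < ε ^ p.toReal := Real.rpow_pos_of_pos hε _
  obtain ⟨c, hc, h⟩ := exists_norm_rpow_uniform_convex X hq
    (η := ε ^ p.toReal / 4) (by positivity)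
  refine ⟨c * ε ^ p.toReal / p.toReal, by positivity, fun f hf g hg hfg => ?_⟩
  have hint (u : Lp X p μ) : Integrable (fun a => ‖u a‖ ^ p.toReal) μ :=
    (Lp.memLp u).integrable_norm_rpow hp0 hp'
  have hmain : ‖f + g‖ ^ p.toReal / 2 ^ p.toReal + c * ‖f - g‖ ^ p.toReal ≤
      (1 / 2 + c * (ε ^ p.toReal / 4)) * (‖f‖ ^ p.toReal + ‖g‖ ^ p.toReal) := by
    simp only [Lp.norm_rpow_eq_integral hp0 hp']
    rw [← integral_div, ← integral_const_mul, ← integral_add ((hint _).div_const _)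
      ((hint _).const_mul _), ← integral_add (hint _) (hint _), ← integral_const_mul]
    refine integral_mono_ae (((hint _).div_const _).add ((hint _).const_mul _))
      (((hint _).add (hint _)).const_mul _) ?_
    filter_upwards [Lp.coeFn_add f g, Lp.coeFn_sub f g] with a hadd hsub
    have := h (f a) (g a)
    rw [Real.div_rpow (norm_nonneg _) zero_le_two] at this
    simpa only [hadd, hsub, Pi.add_apply, Pi.sub_apply] using this
  rw [hf, hg, Real.one_rpow, ← Real.div_rpow (norm_nonneg _) zero_le_two] at hmain
  have hdiff := mul_le_mul_of_nonneg_left (Real.rpow_le_rpow hε.le hfg hq0.le) hc.le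
  have hbern := one_add_mul_self_le_rpow_one_add
    (s := ‖f + g‖ / 2 - 1) (by linarith [norm_nonneg (f + g)]) hq.le
  rw [add_sub_cancel] at hbern
  rw [le_sub_comm, div_le_iff₀ hq0]
  linarith
end
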